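/- For every nonzero linear form v = a·x₁ + b·x₂ (with (a,b) ∈ ℂ² \ {0}), the ℂ-subspace {mk(p·v) : p ∈ S₁₀} of R₁₁ (i.e. the image of S₁₀ under multiplication by v followed by mk) has finrank exactly 26. -/

import Mathlib

open MvPolynomial

noncomputable section

/-- The polynomial ring `ℂ[x₁,x₂,x₃,x₄]`. -/
abbrev S : Type := MvPolynomial (Fin 4) ℂ

/-- The weights `(1,1,2,5)`. -/
def w : Fin 4 → ℕ := ![1, 1, 2, 5]

/-- The Fermat-type polynomial `f₀ = x₁¹⁰ + x₂¹⁰ + x₃⁵ + x₄²`. -/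
def f₀ : S := X 0 ^ 10 + X 1 ^ 10 + X 2 ^ 5 + X 3 ^ 2

/-- The Jacobian ideal of `f₀`, generated by its four partial derivatives. -/
def J : Ideal S :=
  Ideal.span {pderiv 0 f₀, pderiv 1 f₀, pderiv 2 f₀, pderiv 3 f₀}

/-- The Jacobian ring `R = S ⧸ J`. -/
abbrev R : Type := S ⧸ J

/-- The quotient map `mk : S → R` as a `ℂ`-linear map. -/
def mkL : S →ₗ[ℂ] R := (Ideal.Quotient.mkₐ ℂ J).toLinearMap

/-- `S_k`, the space of weighted homogeneous polynomials of weighted degree `k`. -/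
def Sk (k : ℕ) : Submodule ℂ S := weightedHomogeneousSubmodule ℂ w k

/-- `R_k = mk(S_k)`, the image of `S_k` in the Jacobian ring. -/
def Rk (k : ℕ) : Submodule ℂ R := (Sk k).map mkL

theorem Submodule.finrank_map_congr {K V W₁ W₂ : Type*} [DivisionRing K]
    [AddCommGroup V] [Module K V] [AddCommGroup W₁] [Module K W₁] [AddCommGroup W₂] [Module K W₂]
    (f : V →ₗ[K] W₁) (g : V →ₗ[K] W₂) (U : Submodule K V)
    (h : ∀ x ∈ U, f x = 0 ↔ g x = 0) :
    Module.finrank K (U.map f) = Module.finrank K (U.map g) := by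
  have hker : LinearMap.ker (f.domRestrict U) = LinearMap.ker (g.domRestrict U) := by
    ext x
    exact h x x.2
  rw [← LinearMap.range_domRestrict, ← LinearMap.range_domRestrict]
  exact ((f.domRestrict U).quotKerEquivRange.symm.trans
    ((Submodule.quotEquivOfEq _ _ hker).trans (g.domRestrict U).quotKerEquivRange)).finrank_eq

theorem weight_w_apply (d : Fin 4 →₀ ℕ) :
    Finsupp.weight w d = d 0 + d 1 + 2 * d 2 + 5 * d 3 := by
  rw [Finsupp.weight_apply, Finsupp.sum_fintype _ _ (by simp)]
  simp [Fin.sum_univ_four, w]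
  ring

theorem mem_Sk {k : ℕ} {p : S} :
    p ∈ Sk k ↔ ∀ d, coeff d p ≠ 0 → d 0 + d 1 + 2 * d 2 + 5 * d 3 = k := by
  simp only [← weight_w_apply]
  rfl

theorem monomial_mem_Sk {k : ℕ} {d : Fin 4 →₀ ℕ} (hd : d 0 + d 1 + 2 * d 2 + 5 * d 3 = k) :
    (monomial d 1 : S) ∈ Sk k := by
  rw [mem_Sk]
  intro d' hd'
  rw [coeff_monomial] at hd'
  split_ifs at hd' with h
  · rwa [← h]
  · exact absurd rfl hd'

theorem Sk_le {k : ℕ} {N : Submodule ℂ S}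
    (h : ∀ d : Fin 4 →₀ ℕ, d 0 + d 1 + 2 * d 2 + 5 * d 3 = k → (monomial d 1 : S) ∈ N) :
    Sk k ≤ N := by
  intro p hp
  rw [← support_sum_monomial_coeff p]
  refine N.sum_mem fun d hd => ?_
  have := N.smul_mem (coeff d p) (h d (mem_Sk.1 hp d (mem_support_iff.1 hd)))
  rwa [smul_monomial, smul_eq_mul, mul_one] at this

theorem J_eq_span_monomial :
    J = Ideal.span ((fun s => monomial s (1 : ℂ)) ''
      {Finsupp.single 0 9, Finsupp.single 1 9, Finsupp.single 2 4, Finsupp.single 3 1}) := by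
  have hC (n : ℕ) [n.AtLeastTwo] : (C (OfNat.ofNat n) : S) = OfNat.ofNat n := map_ofNat C n
  have h0 : pderiv 0 f₀ = C 10 * X 0 ^ 9 := by
    simp [f₀, pderiv_X, hC]
  have h1 : pderiv 1 f₀ = C 10 * X 1 ^ 9 := by
    simp [f₀, pderiv_X, hC]
  have h2 : pderiv 2 f₀ = C 5 * X 2 ^ 4 := by
    simp [f₀, pderiv_X, hC]
  have h3 : pderiv 3 f₀ = C 2 * X 3 ^ 1 := by
    simp [f₀, pderiv_X, hC]
  have hu (c : ℂ) (hc : c ≠ 0) : IsUnit (C c : S) := (IsUnit.mk0 c hc).map C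
  simp only [J, h0, h1, h2, h3, Set.image_insert_eq, Set.image_singleton, Ideal.span_insert,
    Ideal.span_singleton_mul_left_unit (hu _ (by norm_num : (10 : ℂ) ≠ 0)),
    Ideal.span_singleton_mul_left_unit (hu _ (by norm_num : (5 : ℂ) ≠ 0)),
    Ideal.span_singleton_mul_left_unit (hu _ (by norm_num : (2 : ℂ) ≠ 0)),
    X_pow_eq_monomial]

theorem mem_J {p : S} :
    p ∈ J ↔ ∀ d, coeff d p ≠ 0 → 9 ≤ d 0 ∨ 9 ≤ d 1 ∨ 4 ≤ d 2 ∨ 1 ≤ d 3 := by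
  rw [J_eq_span_monomial, mem_ideal_span_monomial_image]
  simp

/-- Indices of the monomials `x₁^i x₂^j x₃^l` forming a basis of `R₁₁`. -/
abbrev StdIndex : Type :=
  {e : Fin 9 × Fin 9 × Fin 4 // (e.1 : ℕ) + e.2.1 + 2 * e.2.2 = 11}

/-- The exponent vector of a basis monomial of `R₁₁`. -/
def stdExponent (e : StdIndex) : Fin 4 →₀ ℕ :=
  Finsupp.equivFunOnFinite.symm ![e.1.1, e.1.2.1, e.1.2.2, 0]

theorem stdExponent_injective : Function.Injective stdExponent := by
  intro e e' h
  have h' : ∀ i, stdExponent e i = stdExponent e' i := fun i => by rw [h]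
  have h0 := h' 0
  have h1 := h' 1
  have h2 := h' 2
  simp only [stdExponent, Finsupp.equivFunOnFinite_symm_apply_apply] at h0 h1 h2
  exact Subtype.ext (Prod.ext (Fin.ext h0) (Prod.ext (Fin.ext h1) (Fin.ext h2)))

theorem exists_stdExponent_eq {d : Fin 4 →₀ ℕ} (hd : d 0 + d 1 + 2 * d 2 + 5 * d 3 = 11)
    (h : ¬ (9 ≤ d 0 ∨ 9 ≤ d 1 ∨ 4 ≤ d 2 ∨ 1 ≤ d 3)) : ∃ e, stdExponent e = d := by
  push Not at h
  obtain ⟨h0, h1, h2, h3⟩ := h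
  refine ⟨⟨(⟨d 0, h0⟩, ⟨d 1, h1⟩, ⟨d 2, h2⟩), by simp only; omega⟩, ?_⟩
  ext i
  fin_cases i
  · rfl
  · rfl
  · rfl
  · change 0 = d 3
    omega

/-- The coefficients of a polynomial at the basis monomials of `R₁₁`. -/
def stdCoeff : S →ₗ[ℂ] StdIndex → ℂ :=
  LinearMap.pi fun e => lcoeff ℂ (stdExponent e)

theorem stdCoeff_eq_zero_iff {p : S} (hp : p ∈ Sk 11) : stdCoeff p = 0 ↔ p ∈ J := by
  rw [mem_J, funext_iff]
  refine ⟨fun h d hd => ?_, fun h e => ?_⟩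
  · by_contra hn
    obtain ⟨e, rfl⟩ := exists_stdExponent_eq (mem_Sk.1 hp d hd) hn
    exact hd (h e)
  · by_contra hn
    have h0 := e.1.1.2
    have h1 := e.1.2.1.2
    have h2 := e.1.2.2.2
    have := h (stdExponent e) hn
    change 9 ≤ (e.1.1 : ℕ) ∨ 9 ≤ (e.1.2.1 : ℕ) ∨ 4 ≤ (e.1.2.2 : ℕ) ∨ 1 ≤ 0 at this
    omega

theorem stdCoeff_monomial_stdExponent (e : StdIndex) :
    stdCoeff (monomial (stdExponent e) 1) = Pi.single e 1 := by
  ext e'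
  change coeff (stdExponent e') (monomial (stdExponent e) (1 : ℂ)) = _
  rw [coeff_monomial, Pi.single_apply]
  simp only [stdExponent_injective.eq_iff, eq_comm]

theorem monomial_mem_J {d : Fin 4 →₀ ℕ} (h : 9 ≤ d 0 ∨ 9 ≤ d 1 ∨ 4 ≤ d 2 ∨ 1 ≤ d 3) :
    (monomial d 1 : S) ∈ J := by
  rw [mem_J]
  intro d' hd'
  rw [coeff_monomial] at hd'
  split_ifs at hd' with h'
  · rwa [← h']
  · exact absurd rfl hd'

theorem exists_stdCoeff_eq (q : StdIndex → ℂ) : ∃ p ∈ Sk 11, stdCoeff p = q := by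
  refine ⟨∑ e, q e • monomial (stdExponent e) 1, Submodule.sum_mem _ fun e _ =>
    Submodule.smul_mem _ _ (monomial_mem_Sk e.2), ?_⟩
  simp only [map_sum, map_smul, stdCoeff_monomial_stdExponent]
  exact (pi_eq_sum_univ' q).symm

/-- Evaluation at the zero `(b, -a)` of `a x₁ + b x₂`, with `x₃` kept and `x₄` set to zero. -/
def zeroEval (a b : ℂ) : S →ₐ[ℂ] Polynomial ℂ :=
  aeval ![Polynomial.C b, Polynomial.C (-a), Polynomial.X, 0]

/-- The coefficients of `x₃²` and `x₃³` in `zeroEval a b p`. -/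
def zeroEvalCoeff (a b : ℂ) : S →ₗ[ℂ] ℂ × ℂ :=
  ((Polynomial.lcoeff ℂ 2).prod (Polynomial.lcoeff ℂ 3)) ∘ₗ (zeroEval a b).toLinearMap

theorem zeroEvalCoeff_mul (a b : ℂ) (p : S) :
    zeroEvalCoeff a b (p * (a • X 0 + b • X 1)) = 0 := by
  have : zeroEval a b (a • X 0 + b • X 1) = 0 := by
    simp [zeroEval, Polynomial.smul_eq_C_mul, mul_comm]
  simp [zeroEvalCoeff, this]

theorem zeroEvalCoeff_monomial (a b : ℂ) (d : Fin 4 →₀ ℕ) :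
    zeroEvalCoeff a b (monomial d 1) =
      (if d 2 = 2 ∧ d 3 = 0 then b ^ d 0 * (-a) ^ d 1 else 0,
        if d 2 = 3 ∧ d 3 = 0 then b ^ d 0 * (-a) ^ d 1 else 0) := by
  have h : zeroEval a b (monomial d 1) =
      Polynomial.C (b ^ d 0 * (-a) ^ d 1) * Polynomial.X ^ d 2 * 0 ^ d 3 := by
    rw [zeroEval, aeval_monomial, Finsupp.prod_fintype _ _ (by simp)]
    simp [Fin.prod_univ_four]
  rcases Nat.eq_zero_or_pos (d 3) with h3 | h3
  · simp only [zeroEvalCoeff, LinearMap.comp_apply, AlgHom.toLinearMap_apply, h, h3, pow_zero,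
      mul_one, LinearMap.prod_apply, Function.prod_apply, Polynomial.lcoeff_apply,
      Polynomial.coeff_C_mul_X_pow, and_true, eq_comm]
  · simp [zeroEvalCoeff, h, h3.ne']

/-- The map induced by `zeroEvalCoeff` on `R₁₁`. -/
def stdZeroEvalCoeff (a b : ℂ) : (StdIndex → ℂ) →ₗ[ℂ] ℂ × ℂ :=
  Fintype.linearCombination ℂ fun e => zeroEvalCoeff a b (monomial (stdExponent e) 1)

theorem stdZeroEvalCoeff_stdCoeff (a b : ℂ) {p : S} (hp : p ∈ Sk 11) :
    stdZeroEvalCoeff a b (stdCoeff p) = zeroEvalCoeff a b p := by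
  suffices Sk 11 ≤ LinearMap.eqLocus (stdZeroEvalCoeff a b ∘ₗ stdCoeff) (zeroEvalCoeff a b) from
    this hp
  refine Sk_le fun d hd => ?_
  change stdZeroEvalCoeff a b (stdCoeff (monomial d 1)) = zeroEvalCoeff a b (monomial d 1)
  by_cases h : 9 ≤ d 0 ∨ 9 ≤ d 1 ∨ 4 ≤ d 2 ∨ 1 ≤ d 3
  · rw [(stdCoeff_eq_zero_iff (monomial_mem_Sk hd)).2 (monomial_mem_J h), map_zero,
      zeroEvalCoeff_monomial, if_neg (by omega), if_neg (by omega)]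
    rfl
  · obtain ⟨e, rfl⟩ := exists_stdExponent_eq hd h
    rw [stdCoeff_monomial_stdExponent, stdZeroEvalCoeff, Fintype.linearCombination_apply_single,
      one_smul]

theorem mul_mem_Sk_eleven (a b : ℂ) {p : S} (hp : p ∈ Sk 10) :
    p * (a • X 0 + b • X 1) ∈ Sk 11 := by
  have hX (i : Fin 4) (hi : w i = 1) : (X i : S) ∈ Sk 1 := by
    have := isWeightedHomogeneous_X ℂ w i
    rwa [hi] at this
  exact IsWeightedHomogeneous.mul (n := 1) hp
    ((Sk 1).add_mem ((Sk 1).smul_mem a (hX 0 rfl)) ((Sk 1).smul_mem b (hX 1 rfl)))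

/-- Modulo the multiples of `s X_i + t X_j` with `s ≠ 0` and the Jacobian ideal, the polynomials
of weighted degree `11` are spanned by `X_j⁷ x₃²` and `X_j⁵ x₃³`. -/
theorem exists_stdCoeff_eq_add {i j : Fin 4} (hij : i = 0 ∧ j = 1 ∨ i = 1 ∧ j = 0) {s t : ℂ}
    (hs : s ≠ 0) {p : S} (hp : p ∈ Sk 11) :
    ∃ r ∈ Sk 10, ∃ α β : ℂ, stdCoeff p = stdCoeff (r * (s • X i + t • X j) +
      α • monomial (Finsupp.single j 7 + Finsupp.single 2 2) 1 +
      β • monomial (Finsupp.single j 5 + Finsupp.single 2 3) 1) := by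
  set v : S := s • X i + t • X j with hv
  set m₂ : S := monomial (Finsupp.single j 7 + Finsupp.single 2 2) 1
  set m₃ : S := monomial (Finsupp.single j 5 + Finsupp.single 2 3) 1
  let N : Submodule ℂ S := (Sk 10).map (LinearMap.mulRight ℂ v) ⊔ LinearMap.ker stdCoeff ⊔
    Submodule.span ℂ {m₂, m₃}
  have hker : LinearMap.ker stdCoeff ≤ N := le_sup_right.trans le_sup_left
  have hspan : Submodule.span ℂ {m₂, m₃} ≤ N := le_sup_right
  have hmul : (Sk 10).map (LinearMap.mulRight ℂ v) ≤ N := le_sup_left.trans le_sup_left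
  have key : ∀ n (d : Fin 4 →₀ ℕ), d i = n → d 0 + d 1 + 2 * d 2 + 5 * d 3 = 11 →
      (monomial d 1 : S) ∈ N := by
    intro n
    induction n with
    | zero =>
      intro d hi hd
      by_cases h : 9 ≤ d 0 ∨ 9 ≤ d 1 ∨ 4 ≤ d 2 ∨ 1 ≤ d 3
      · exact hker ((stdCoeff_eq_zero_iff (monomial_mem_Sk hd)).2 (monomial_mem_J h))
      · have hcases : d 2 = 2 ∨ d 2 = 3 := by
          rcases hij with ⟨rfl, rfl⟩ | ⟨rfl, rfl⟩ <;> omega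
        rcases hcases with h2 | h2
        · have : d = Finsupp.single j 7 + Finsupp.single 2 2 := by
            ext k
            rcases hij with ⟨rfl, rfl⟩ | ⟨rfl, rfl⟩ <;> fin_cases k <;>
              simp <;> omega
          rw [this]
          exact hspan (Submodule.subset_span (by simp [m₂]))
        · have : d = Finsupp.single j 5 + Finsupp.single 2 3 := by
            ext k
            rcases hij with ⟨rfl, rfl⟩ | ⟨rfl, rfl⟩ <;> fin_cases k <;>
              simp <;> omega
          rw [this]
          exact hspan (Submodule.subset_span (by simp [m₃]))
    | succ n ih =>
      intro d hi hd
      obtain ⟨c, rfl⟩ : ∃ c, d = c + Finsupp.single i 1 :=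
        ⟨d - Finsupp.single i 1, (tsub_add_cancel_of_le (by simp [hi])).symm⟩
      have hc : c 0 + c 1 + 2 * c 2 + 5 * c 3 = 10 := by
        rcases hij with ⟨rfl, rfl⟩ | ⟨rfl, rfl⟩ <;> simp at hd <;> omega
      have hj : (monomial (c + Finsupp.single j 1) 1 : S) ∈ N := by
        apply ih
        · rcases hij with ⟨rfl, rfl⟩ | ⟨rfl, rfl⟩ <;> simpa using hi
        · rcases hij with ⟨rfl, rfl⟩ | ⟨rfl, rfl⟩ <;> simp <;> omega
      have hcv : (monomial c 1 : S) * v ∈ N :=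
        hmul (Submodule.mem_map_of_mem (f := LinearMap.mulRight ℂ v) (monomial_mem_Sk hc))
      have heq : (monomial (c + Finsupp.single i 1) 1 : S) =
          s⁻¹ • (monomial c 1 * v - t • monomial (c + Finsupp.single j 1) 1) := by
        have hX (k : Fin 4) : (monomial (c + Finsupp.single k 1) 1 : S) = monomial c 1 * X k := by
          rw [X, monomial_mul, one_mul]
        rw [hX, hX, hv, mul_add, mul_smul_comm, mul_smul_comm, add_sub_cancel_right,
          inv_smul_smul₀ hs]
      rw [heq]
      exact N.smul_mem _ (N.sub_mem hcv (N.smul_mem _ hj))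
  obtain ⟨y, hy, z, hz, hyz⟩ := Submodule.mem_sup.1 (Sk_le (fun d => key _ d rfl) hp)
  obtain ⟨u, ⟨r, hr, rfl⟩, k, hk, rfl⟩ := Submodule.mem_sup.1 hy
  obtain ⟨α, β, rfl⟩ := Submodule.mem_span_pair.1 hz
  refine ⟨r, hr, α, β, ?_⟩
  rw [← hyz, map_add, map_add, LinearMap.mem_ker.1 hk, add_assoc (r * v)]
  simp [LinearMap.mulRight_apply]

/-- For every nonzero linear form `v = a·x₁ + b·x₂`, the subspace
`{mk(p·v) : p ∈ S₁₀}` of `R₁₁` has dimension exactly 26. -/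
theorem fiber_dimension (a b : ℂ) (hab : (a, b) ≠ (0, 0)) :
    Module.finrank ℂ
      (Submodule.map (mkL ∘ₗ LinearMap.mulRight ℂ (a • X 0 + b • X 1)) (Sk 10)) = 26 := by
  obtain ⟨i, j, s, t, c, hij, hs, hc, hv, hτ₂, hτ₃⟩ : ∃ (i j : Fin 4) (s t c : ℂ),
      (i = 0 ∧ j = 1 ∨ i = 1 ∧ j = 0) ∧ s ≠ 0 ∧ c ≠ 0 ∧
      (a • X 0 + b • X 1 : S) = s • X i + t • X j ∧
      zeroEvalCoeff a b (monomial (Finsupp.single j 7 + Finsupp.single 2 2) 1) = (c ^ 7, 0) ∧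
      zeroEvalCoeff a b (monomial (Finsupp.single j 5 + Finsupp.single 2 3) 1) = (0, c ^ 5) := by
    by_cases ha : a = 0
    · have hb : b ≠ 0 := fun hb => hab (by rw [ha, hb])
      exact ⟨1, 0, b, a, b, by simp, hb, hb, add_comm _ _, by simp [zeroEvalCoeff_monomial],
        by simp [zeroEvalCoeff_monomial]⟩
    · exact ⟨0, 1, a, b, -a, by simp, ha, neg_ne_zero.2 ha, rfl, by simp [zeroEvalCoeff_monomial],
        by simp [zeroEvalCoeff_monomial]⟩
  have hm₂ : (monomial (Finsupp.single j 7 + Finsupp.single 2 2) 1 : S) ∈ Sk 11 := by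
    apply monomial_mem_Sk
    rcases hij with ⟨rfl, rfl⟩ | ⟨rfl, rfl⟩ <;> simp
  have hm₃ : (monomial (Finsupp.single j 5 + Finsupp.single 2 3) 1 : S) ∈ Sk 11 := by
    apply monomial_mem_Sk
    rcases hij with ⟨rfl, rfl⟩ | ⟨rfl, rfl⟩ <;> simp
  have hT₂ := (stdZeroEvalCoeff_stdCoeff a b hm₂).trans hτ₂
  have hT₃ := (stdZeroEvalCoeff_stdCoeff a b hm₃).trans hτ₃
  have hTv (r : S) (hr : r ∈ Sk 10) :
      stdZeroEvalCoeff a b (stdCoeff (r * (a • X 0 + b • X 1))) = 0 := by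
    rw [stdZeroEvalCoeff_stdCoeff a b (mul_mem_Sk_eleven a b hr), zeroEvalCoeff_mul]
  have hrange : LinearMap.range (stdZeroEvalCoeff a b) = ⊤ := by
    refine LinearMap.range_eq_top.2 fun ⟨x, y⟩ => ⟨(x / c ^ 7) • stdCoeff (monomial
      (Finsupp.single j 7 + Finsupp.single 2 2) 1) + (y / c ^ 5) • stdCoeff (monomial
      (Finsupp.single j 5 + Finsupp.single 2 3) 1), ?_⟩
    rw [map_add, map_smul, map_smul, hT₂, hT₃]
    simp [hc]
  have hmap : ((Sk 10).map (LinearMap.mulRight ℂ (a • X 0 + b • X 1))).map stdCoeff =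
      LinearMap.ker (stdZeroEvalCoeff a b) := by
    apply le_antisymm
    · rintro _ ⟨_, ⟨r, hr, rfl⟩, rfl⟩
      exact hTv r hr
    · intro q hq
      obtain ⟨p, hp, rfl⟩ := exists_stdCoeff_eq q
      obtain ⟨r, hr, α, β, h⟩ := exists_stdCoeff_eq_add hij (t := t) hs hp
      rw [← hv] at h
      have hαβ : α = 0 ∧ β = 0 := by
        rw [LinearMap.mem_ker, h, map_add, map_add, map_add, map_add, hTv r hr, map_smul,
          map_smul, map_smul, map_smul, hT₂, hT₃] at hq
        simpa [hc] using hq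
      rw [hαβ.1, hαβ.2, zero_smul, zero_smul, add_zero, add_zero] at h
      exact ⟨_, ⟨r, hr, rfl⟩, h.symm⟩
  rw [Submodule.map_comp, Submodule.finrank_map_congr mkL stdCoeff, hmap]
  · have hrn := (stdZeroEvalCoeff a b).finrank_range_add_finrank_ker
    have hcard : Fintype.card StdIndex = 28 := by decide
    rw [hrange, finrank_top, Module.finrank_prod, Module.finrank_self,
      Module.finrank_fintype_fun_eq_card, hcard] at hrn
    omega
  · rintro _ ⟨r, hr, rfl⟩
    rw [LinearMap.mulRight_apply, stdCoeff_eq_zero_iff (mul_mem_Sk_eleven a b hr)]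
    exact Ideal.Quotient.eq_zero_iff_mem
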